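/- Let Ω be a finite set of cardinality d = 2^k such that d − 1 is a prime number. If G ⊆ Sym(Ω) is a primitive solvable subgroup, then every nonidentity element of G has at most 2 fixed points on Ω. -/

import Mathlib

/-- A subgroup `G` of `Sym(Ω)` is primitive if it acts transitively on `Ω`
and every point stabilizer is a maximal subgroup of `G`. -/
def IsPrimitivePermSubgroup {Ω : Type*} [Fintype Ω] (G : Subgroup (Equiv.Perm Ω)) : Prop :=
  MulAction.IsPretransitive G Ω ∧ ∀ x : Ω, IsCoatom (MulAction.stabilizer G x)

/-- `A` is a minimal normal subgroup: nontrivial, normal, and containing no smaller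
nontrivial normal subgroup. -/
def IsMinimalNormalSubgroup {H : Type*} [Group H] (A : Subgroup H) : Prop :=
  A.Normal ∧ A ≠ ⊥ ∧ ∀ B : Subgroup H, B.Normal → B ≠ ⊥ → B ≤ A → B = A

namespace MersenneFixedPoint

/-- A nontrivial solvable group has a nontrivial normal abelian subgroup. -/
theorem exists_normal_abelian {H : Type*} [Group H] [Nontrivial H] (hs : Group.IsSolvable H) :
    ∃ A : Subgroup H, A.Normal ∧ A ≠ ⊥ ∧ ∀ a ∈ A, ∀ b ∈ A, a * b = b * a := by
  classical
  have hex : ∃ n, derivedSeries H n = ⊥ := hs.solvable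
  obtain ⟨m, hm⟩ : ∃ m, Nat.find hex = m + 1 := by
    refine Nat.exists_eq_succ_of_ne_zero fun h0 => ?_
    have := Nat.find_spec hex
    rw [h0, derivedSeries_zero] at this
    exact top_ne_bot this
  refine ⟨derivedSeries H m, derivedSeries_normal H m, Nat.find_min hex (by omega), ?_⟩
  have h1 : ⁅derivedSeries H m, derivedSeries H m⁆ = ⊥ := by
    rw [← derivedSeries_succ, ← hm]
    exact Nat.find_spec hex
  intro a ha b hb
  rw [← commutatorElement_eq_one_iff_mul_comm, ← Subgroup.mem_bot, ← h1]
  exact Subgroup.commutator_mem_commutator ha hb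

section Linear

variable {H V : Type*} [Group H] [AddCommGroup V] [DistribMulAction H V]

/-- The vectors fixed by every element of `B`. -/
def fixedVectors (V : Type*) [AddCommGroup V] [DistribMulAction H V] (B : Subgroup H) :
    AddSubgroup V :=
  FixedPoints.addSubgroup B V

theorem mem_fixedVectors {B : Subgroup H} {v : V} :
    v ∈ fixedVectors V B ↔ ∀ b ∈ B, b • v = v := by
  simp [fixedVectors, Subgroup.smul_def]

theorem fixedVectors_sup (B C : Subgroup H) :
    fixedVectors V (B ⊔ C) = fixedVectors V B ⊓ fixedVectors V C := by
  ext v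
  have key : ∀ D : Subgroup H, v ∈ fixedVectors V D ↔ D ≤ MulAction.stabilizer H v := fun D => by
    rw [mem_fixedVectors]; rfl
  rw [AddSubgroup.mem_inf, key, key, key, sup_le_iff]

theorem eq_bot_of_fixedVectors_eq_top [FaithfulSMul H V] {B : Subgroup H}
    (h : fixedVectors V B = ⊤) : B = ⊥ := by
  refine (Subgroup.eq_bot_iff_forall B).2 fun b hb => FaithfulSMul.eq_of_smul_eq_smul fun v : V => ?_
  rw [one_smul]
  exact mem_fixedVectors.1 (h ▸ AddSubgroup.mem_top v) b hb

theorem smul_mem_fixedVectors_conj {B : Subgroup H} (h : H) {v : V} (hv : v ∈ fixedVectors V B) :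
    h • v ∈ fixedVectors V (B.map (MulAut.conj h).toMonoidHom) := by
  rw [mem_fixedVectors] at hv ⊢
  rintro _ ⟨b, hb, rfl⟩
  simp [mul_smul, hv b hb]

theorem map_conj_map_conj (B : Subgroup H) (g h : H) :
    (B.map (MulAut.conj h).toMonoidHom).map (MulAut.conj g).toMonoidHom =
      B.map (MulAut.conj (g * h)).toMonoidHom := by
  rw [Subgroup.map_map]
  congr 1
  ext x
  simp [mul_assoc]

theorem map_conj_one (B : Subgroup H) : B.map (MulAut.conj (1 : H)).toMonoidHom = B := by
  rw [map_one]
  exact B.map_id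

theorem card_fixedVectors_conj (B : Subgroup H) (h : H) :
    Nat.card (fixedVectors V (B.map (MulAut.conj h).toMonoidHom)) =
      Nat.card (fixedVectors V B) := by
  refine (Nat.card_congr (Equiv.subtypeEquiv (MulAction.toPerm h) fun v => ?_)).symm
  refine ⟨fun hv => smul_mem_fixedVectors_conj h hv, fun hv => ?_⟩
  have := smul_mem_fixedVectors_conj h⁻¹ hv
  rwa [map_conj_map_conj, inv_mul_cancel, map_conj_one, MulAction.toPerm_apply, inv_smul_smul]
    at this

/-- `B` is a subgroup of `A` with a nonzero fixed vector. -/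
def FixesNonzero (V : Type*) [AddCommGroup V] [DistribMulAction H V] (A B : Subgroup H) : Prop :=
  B ≤ A ∧ fixedVectors V B ≠ ⊥

theorem FixesNonzero.conj {A B : Subgroup H} [hA : A.Normal] (hB : FixesNonzero V A B) (h : H) :
    FixesNonzero V A (B.map (MulAut.conj h).toMonoidHom) := by
  refine ⟨?_, fun hbot => hB.2 ?_⟩
  · rintro _ ⟨b, hb, rfl⟩
    exact hA.conj_mem b (hB.1 hb) h
  · rw [← AddSubgroup.card_eq_one] at hbot ⊢
    rwa [card_fixedVectors_conj] at hbot

theorem maximal_fixesNonzero_conj {A B : Subgroup H} [A.Normal]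
    (hB : Maximal (FixesNonzero V A) B) (h : H) :
    Maximal (FixesNonzero V A) (B.map (MulAut.conj h).toMonoidHom) := by
  refine ⟨hB.prop.conj h, fun C hC hle => ?_⟩
  have h1 := hB.le_of_ge (hC.conj h⁻¹) (by
    have := Subgroup.map_mono (f := (MulAut.conj h⁻¹).toMonoidHom) hle
    rwa [map_conj_map_conj, inv_mul_cancel, map_conj_one] at this)
  have h2 := Subgroup.map_mono (f := (MulAut.conj h).toMonoidHom) h1
  rwa [map_conj_map_conj, mul_inv_cancel, map_conj_one] at h2

/-- If `A` is abelian, then the fixed spaces of the maximal subgroups of `A` having nonzero fixed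
vectors are independent. -/
theorem eq_zero_of_sum_eq_zero {A : Subgroup H} (hcomm : ∀ a ∈ A, ∀ b ∈ A, a * b = b * a)
    (s : Finset (Subgroup H)) (hs : ∀ B ∈ s, Maximal (FixesNonzero V A) B)
    (v : Subgroup H → V) (hv : ∀ B ∈ s, v B ∈ fixedVectors V B) (hsum : ∑ B ∈ s, v B = 0) :
    ∀ B ∈ s, v B = 0 := by
  classical
  induction s using Finset.induction_on generalizing v with
  | empty => simp
  | insert C s hCs ih =>
    have hC : Maximal (FixesNonzero V A) C := hs C (Finset.mem_insert_self C s)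
    have hs' : ∀ B ∈ s, Maximal (FixesNonzero V A) B :=
      fun B hB => hs B (Finset.mem_insert_of_mem hB)
    have hfix : ∀ B ∈ s, v B ∈ fixedVectors V C := by
      intro B hB
      rw [mem_fixedVectors]
      intro c hc
      refine sub_eq_zero.1 (ih hs' (fun B => c • v B - v B) (fun D hD => ?_) ?_ B hB)
      · have hvD := hv D (Finset.mem_insert_of_mem hD)
        refine AddSubgroup.sub_mem _ ?_ hvD
        rw [mem_fixedVectors] at hvD ⊢
        intro d hd
        rw [← mul_smul, hcomm d ((hs' D hD).prop.1 hd) c (hC.prop.1 hc), mul_smul, hvD d hd]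
      · have h0 := congrArg (fun x => c • x - x) hsum
        simp only [smul_zero, sub_zero, Finset.sum_insert hCs, smul_add,
          mem_fixedVectors.1 (hv C (Finset.mem_insert_self C s)) c hc] at h0
        rw [Finset.sum_sub_distrib, ← Finset.smul_sum]
        rw [← h0]
        abel
    have hzero : ∀ B ∈ s, v B = 0 := by
      intro B hB
      by_contra hne
      have hBC : FixesNonzero V A (B ⊔ C) := by
        refine ⟨sup_le (hs' B hB).prop.1 hC.prop.1, fun hbot => hne ?_⟩
        rw [← AddSubgroup.mem_bot, ← hbot, fixedVectors_sup]
        exact ⟨hv B (Finset.mem_insert_of_mem hB), hfix B hB⟩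
      have h1 : C ≤ B := le_sup_right.trans ((hs' B hB).le_of_ge hBC le_sup_left)
      have h2 : B ≤ C := le_sup_left.trans (hC.le_of_ge hBC le_sup_right)
      exact hCs (le_antisymm h1 h2 ▸ hB)
    intro B hB
    rcases Finset.mem_insert.1 hB with rfl | hB
    · rwa [Finset.sum_insert hCs, Finset.sum_eq_zero hzero, add_zero] at hsum
    · exact hzero B hB

/-- Every invariant subgroup is trivial. -/
def IsIrreducibleAction (H V : Type*) [Group H] [AddCommGroup V] [DistribMulAction H V] : Prop :=
  ∀ W : AddSubgroup V, (∀ (h : H), ∀ w ∈ W, h • w ∈ W) → W = ⊥ ∨ W = ⊤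

/-- In an irreducible action, `V` is a power of the fixed space of a maximal subgroup of `A`
having nonzero fixed vectors. -/
theorem exists_card_eq_pow [Finite H] [Finite V] (hirr : IsIrreducibleAction H V)
    {A B : Subgroup H} [A.Normal] (hcomm : ∀ a ∈ A, ∀ b ∈ A, a * b = b * a)
    (hB : Maximal (FixesNonzero V A) B) :
    ∃ t, Nat.card V = Nat.card (fixedVectors V B) ^ t := by
  classical
  let s : Finset (Subgroup H) :=
    (Set.toFinite (Set.range fun h : H => B.map (MulAut.conj h).toMonoidHom)).toFinset
  have mem_s : ∀ C, C ∈ s ↔ ∃ h : H, B.map (MulAut.conj h).toMonoidHom = C := by simp [s]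
  let f : ((C : s) → fixedVectors V C.1) →+ V :=
    { toFun := fun v => ∑ C, (v C : V)
      map_zero' := by simp
      map_add' := by simp [Finset.sum_add_distrib] }
  have hinj : Function.Injective f := by
    rw [injective_iff_map_eq_zero]
    intro v hv
    have hmax : ∀ C ∈ s, Maximal (FixesNonzero V A) C := by
      intro C hC
      obtain ⟨h, rfl⟩ := (mem_s C).1 hC
      exact maximal_fixesNonzero_conj hB h
    have := eq_zero_of_sum_eq_zero hcomm s hmax
      (fun C => if hC : C ∈ s then (v ⟨C, hC⟩ : V) else 0)
      (fun C hC => by simp [hC]) (by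
        rw [← Finset.sum_coe_sort]
        simpa [f] using hv)
    ext C
    simpa using this C.1 C.2
  have hsurj : Function.Surjective f := by
    let W : AddSubgroup V := ⨆ C : s, fixedVectors V C.1
    have hle : ∀ C ∈ s, fixedVectors V C ≤ W :=
      fun C hC => le_iSup (fun C : s => fixedVectors V C.1) ⟨C, hC⟩
    have hBs : B ∈ s := (mem_s B).2 ⟨1, map_conj_one B⟩
    have hW : W = ⊤ := by
      refine (hirr W fun h w hw => ?_).resolve_left fun hbot => hB.prop.2 ?_
      · induction hw using AddSubgroup.iSup_induction' with
        | h1 => simp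
        | hadd x y _ _ hx hy => rw [smul_add]; exact W.add_mem hx hy
        | hp C x hx =>
          refine hle _ ?_ (smul_mem_fixedVectors_conj h hx)
          obtain ⟨g, hg⟩ := (mem_s C.1).1 C.2
          exact (mem_s _).2 ⟨h * g, by rw [← hg, map_conj_map_conj]⟩
      · exact le_bot_iff.1 (hbot ▸ hle B hBs)
    rw [← AddMonoidHom.range_eq_top, ← top_le_iff, ← hW]
    refine iSup_le fun C x hx => ⟨Pi.single C ⟨x, hx⟩, ?_⟩
    change ∑ D, ((Pi.single C ⟨x, hx⟩ : (C : s) → fixedVectors V C.1) D : V) = x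
    rw [Finset.sum_eq_single C]
    · simp
    · intro D _ hD
      simp [Pi.single_eq_of_ne hD]
    · simp
  refine ⟨Fintype.card s, ?_⟩
  rw [← Nat.card_congr (Equiv.ofBijective f ⟨hinj, hsurj⟩), Nat.card_pi,
    Finset.prod_congr rfl (g := fun _ => Nat.card (fixedVectors V B)), Finset.prod_const,
    Finset.card_univ]
  intro C _
  obtain ⟨h, hh⟩ := (mem_s C.1).1 C.2
  rw [← hh, card_fixedVectors_conj]

theorem eq_two_or_eq_of_prime_pow_sub_one {c t : ℕ} (hc : 2 ≤ c) (hp : (c ^ t - 1).Prime) :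
    c = 2 ∨ c = c ^ t := by
  have hdvd : c - 1 ∣ c ^ t - 1 := by simpa only [one_pow] using Nat.sub_dvd_pow_sub_pow c 1 t
  have := hp.two_le
  rcases (Nat.dvd_prime hp).1 hdvd with h | h <;> omega

/-- An abelian normal subgroup of an irreducible group acts freely on the nonzero vectors. -/
theorem eq_one_of_smul_eq [Finite H] [Finite V] [FaithfulSMul H V]
    (hirr : IsIrreducibleAction H V) (hp : (Nat.card V - 1).Prime)
    {A : Subgroup H} [hA : A.Normal] (hcomm : ∀ a ∈ A, ∀ b ∈ A, a * b = b * a)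
    {a : H} (ha : a ∈ A) {v : V} (hv : v ≠ 0) (hav : a • v = v) : a = 1 := by
  have hfix : FixesNonzero V A (Subgroup.zpowers a) := by
    refine ⟨by simpa using ha, fun hbot => hv ?_⟩
    rw [← AddSubgroup.mem_bot, ← hbot, mem_fixedVectors]
    have : Subgroup.zpowers a ≤ MulAction.stabilizer H v := by simpa using hav
    exact fun b hb => this hb
  obtain ⟨B, hle, hB⟩ := (Set.toFinite {B | FixesNonzero V A B}).exists_le_maximal hfix
  change Maximal (FixesNonzero V A) B at hB
  suffices hbot : B = ⊥ by
    rw [hbot, le_bot_iff, Subgroup.zpowers_eq_bot] at hle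
    exact hle
  obtain ⟨t, ht⟩ := exists_card_eq_pow hirr hcomm hB
  have hc : 2 ≤ Nat.card (fixedVectors V B) := by
    have h1 := hB.prop.2
    rw [Ne, ← AddSubgroup.card_eq_one] at h1
    have h2 : 0 < Nat.card (fixedVectors V B) := Nat.card_pos
    omega
  rw [ht] at hp
  rcases eq_two_or_eq_of_prime_pow_sub_one hc hp with h | h
  · obtain ⟨⟨w, hw⟩, hw0'⟩ := AddSubgroup.ne_bot_iff_exists_ne_zero.1 hB.prop.2
    have hw0 : w ≠ 0 := fun h => hw0' (Subtype.ext h)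
    have hAw : w ∈ fixedVectors V A := by
      rw [mem_fixedVectors]
      intro c hc
      have hcw : c • w ∈ fixedVectors V B := by
        rw [mem_fixedVectors] at hw ⊢
        intro b hb
        rw [← mul_smul, hcomm b (hB.prop.1 hb) c hc, mul_smul, hw b hb]
      rw [Nat.card_eq_two_iff' (0 : fixedVectors V B)] at h
      obtain ⟨y, -, hy⟩ := h
      have h1 := hy ⟨w, hw⟩ hw0'
      have h2 := hy ⟨_, hcw⟩ (fun h => hw0 ((smul_eq_zero_iff_eq c).1 (congrArg Subtype.val h)))
      exact congrArg Subtype.val (h2.trans h1.symm)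
    have hAtop : fixedVectors V A = ⊤ := by
      refine (hirr _ fun h x hx => ?_).resolve_left fun hbot => hw0 ?_
      · rw [mem_fixedVectors] at hx ⊢
        intro b hb
        have := hx _ (hA.conj_mem b hb h⁻¹)
        rw [inv_inv, mul_smul, mul_smul, inv_smul_eq_iff] at this
        exact this
      · rw [← AddSubgroup.mem_bot, ← hbot]
        exact hAw
    exact le_bot_iff.1 (eq_bot_of_fixedVectors_eq_top hAtop ▸ hB.prop.1)
  · exact eq_bot_of_fixedVectors_eq_top ((AddSubgroup.card_eq_iff_eq_top _).1 (h.trans ht.symm))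

/-- A nontrivial group acting freely on a set of prime cardinality has that cardinality and acts
transitively. -/
theorem card_eq_and_isPretransitive {A X : Type*} [Group A] [Nontrivial A] [MulAction A X]
    [Finite X] (hp : (Nat.card X).Prime) (hfree : ∀ x : X, MulAction.stabilizer A x = ⊥) :
    Nat.card A = Nat.card X ∧ MulAction.IsPretransitive A X := by
  have hcard := Nat.card_congr (MulAction.selfEquivOrbitsQuotientProd hfree)
  rw [Nat.card_prod] at hcard
  have hA : Nat.card A ≠ 1 := fun h => by
    rw [Nat.card_eq_one_iff_unique] at h
    exact not_subsingleton A h.1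
  have hA' := ((Nat.dvd_prime hp).1 (Dvd.intro_left _ hcard.symm)).resolve_left hA
  have hone : Nat.card (Quotient (MulAction.orbitRel A X)) = 1 := by
    rw [hA'] at hcard
    exact Nat.eq_of_mul_eq_mul_right hp.pos (by rw [← hcard, one_mul])
  refine ⟨hA', ?_⟩
  rw [MulAction.pretransitive_iff_subsingleton_quotient]
  exact (Nat.card_eq_one_iff_unique.1 hone).1

/-- A nontrivial element of a solvable irreducible linear group fixes at most one nonzero vector if
the number of nonzero vectors is prime. -/
theorem card_fixed_le_two [Finite H] [Finite V] [FaithfulSMul H V] (hs : Group.IsSolvable H)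
    (hirr : IsIrreducibleAction H V) (hp : (Nat.card V - 1).Prime) {h : H} (hh : h ≠ 1) :
    Nat.card {v : V | h • v = v} ≤ 2 := by
  have : Nontrivial H := ⟨h, 1, hh⟩
  obtain ⟨A, hA, hAbot, hcomm⟩ := exists_normal_abelian hs
  have : Nontrivial A := (Subgroup.nontrivial_iff_ne_bot A).2 hAbot
  let X := {v : V // v ≠ 0}
  let _ : MulAction A X :=
    { smul := fun a x => ⟨a • x.1, (smul_ne_zero_iff_ne a).2 x.2⟩
      one_smul := fun x => Subtype.ext (one_smul A x.1)
      mul_smul := fun a b x => Subtype.ext (mul_smul a b x.1) }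
  have hX : Nat.card X = Nat.card V - 1 := by
    have := Fintype.ofFinite V
    classical
    simp [X, Nat.card_eq_fintype_card, Fintype.card_subtype_compl]
  have hfree : ∀ a ∈ A, ∀ v : V, v ≠ 0 → a • v = v → a = 1 :=
    fun a ha v hv hav => eq_one_of_smul_eq hirr hp hcomm ha hv hav
  obtain ⟨hcard, htrans⟩ := card_eq_and_isPretransitive (A := A) (X := X) (hX ▸ hp) fun x => by
    refine (Subgroup.eq_bot_iff_forall _).2 fun a ha => Subtype.ext ?_
    exact hfree a a.2 x.1 x.2 (congrArg Subtype.val ha)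
  have htrans' : ∀ v w : V, v ≠ 0 → w ≠ 0 → ∃ a ∈ A, a • v = w := by
    intro v w hv hw
    obtain ⟨a, ha⟩ := MulAction.exists_smul_eq A (⟨v, hv⟩ : X) ⟨w, hw⟩
    exact ⟨a, a.2, congrArg Subtype.val ha⟩
  by_contra! hlt
  have hle : ∀ v w : V, v ≠ 0 → h • v = v → h • w = w → w ≠ 0 → w = v := by
    intro v w hv hhv hhw hw
    by_contra hne
    obtain ⟨a, ha, rfl⟩ := htrans' v w hv hw
    have hcommute : h * a * h⁻¹ = a := by
      have h1 : a⁻¹ * (h * a * h⁻¹) = 1 := by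
        refine hfree _ (A.mul_mem (A.inv_mem ha) (hA.conj_mem a ha h)) v hv ?_
        rw [mul_smul, mul_smul, inv_smul_eq_iff.2 hhv.symm, mul_smul, hhw, inv_smul_smul]
      exact (inv_mul_eq_one.1 h1).symm
    have hprime : Fact (Nat.card A).Prime := ⟨by rw [hcard, hX]; exact hp⟩
    have hcent : ∀ b ∈ A, h * b = b * h := by
      intro b hb
      have hdisj := ((Subgroup.centralizer {h}).subgroupOf A).eq_bot_or_eq_top_of_prime_card
      have haC : (⟨a, ha⟩ : A) ∈ (Subgroup.centralizer {h}).subgroupOf A := by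
        rw [Subgroup.mem_subgroupOf, Subgroup.mem_centralizer_singleton_iff]
        exact (mul_inv_eq_iff_eq_mul.1 hcommute).symm
      rcases hdisj with hd | hd
      · rw [hd, Subgroup.mem_bot] at haC
        have : a = 1 := congrArg Subtype.val haC
        exact absurd (by rw [this, one_smul]) hne
      · have : (⟨b, hb⟩ : A) ∈ (Subgroup.centralizer {h}).subgroupOf A := hd ▸ Subgroup.mem_top _
        rw [Subgroup.mem_subgroupOf, Subgroup.mem_centralizer_singleton_iff] at this
        exact this.symm
    refine hh (FaithfulSMul.eq_of_smul_eq_smul fun u : V => ?_)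
    rw [one_smul]
    rcases eq_or_ne u 0 with rfl | hu
    · exact smul_zero h
    · obtain ⟨b, hb, rfl⟩ := htrans' v u hv hu
      rw [← mul_smul, hcent b hb, mul_smul, hhv]
  rw [Nat.card_coe_set_eq, Set.two_lt_ncard_iff] at hlt
  obtain ⟨x, y, z, hx, hy, hz, hxy, hxz, hyz⟩ := hlt
  rcases eq_or_ne x 0 with rfl | hx0
  · exact hyz (hle z y hxz.symm hz hy hxy.symm)
  · rcases eq_or_ne y 0 with rfl | hy0
    · exact hxz (hle z x hyz.symm hz hx hx0)
    · exact hxy (hle y x hy0 hy hx hx0)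

end Linear

section Permutation

variable {G Ω : Type*} [Group G] [MulAction G Ω]

/-- A transitive abelian subgroup of a faithful group acts regularly. -/
theorem bijective_smul_of_commute [FaithfulSMul G Ω] {N : Subgroup G}
    [MulAction.IsPretransitive N Ω] (hcomm : ∀ a ∈ N, ∀ b ∈ N, a * b = b * a) (x : Ω) :
    Function.Bijective fun n : N => n • x := by
  refine ⟨fun m n hmn => Subtype.ext ?_, MulAction.surjective_smul N x⟩
  refine FaithfulSMul.eq_of_smul_eq_smul fun y : Ω => ?_
  obtain ⟨a, rfl⟩ := MulAction.exists_smul_eq N x y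
  change (m : G) • (a : G) • x = (n : G) • (a : G) • x
  rw [← mul_smul, ← mul_smul, hcomm _ m.2 _ a.2, hcomm _ n.2 _ a.2, mul_smul, mul_smul]
  exact congrArg ((a : G) • ·) hmn

theorem isPretransitive_of_normal_ne_bot [FaithfulSMul G Ω] [MulAction.IsPreprimitive G Ω]
    {N : Subgroup G} [N.Normal] (hN : N ≠ ⊥) : MulAction.IsPretransitive N Ω := by
  refine MulAction.IsQuasiPreprimitive.isPretransitive_of_normal (G := G) fun huniv => hN ?_
  refine (Subgroup.eq_bot_iff_forall N).2 fun n hn => ?_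
  refine FaithfulSMul.eq_of_smul_eq_smul fun y : Ω => ?_
  rw [one_smul]
  have hy : y ∈ MulAction.fixedPoints N Ω := huniv ▸ Set.mem_univ y
  exact hy ⟨n, hn⟩

/-- In a faithful primitive solvable action whose degree minus one is prime, a nonidentity element
has at most two fixed points. -/
theorem card_fixedBy_le_two [Finite G] [FaithfulSMul G Ω] [MulAction.IsPreprimitive G Ω]
    (hs : Group.IsSolvable G) (hp : (Nat.card Ω - 1).Prime) {g : G} (hg : g ≠ 1) :
    Nat.card (MulAction.fixedBy Ω g) ≤ 2 := by
  rcases isEmpty_or_nonempty (MulAction.fixedBy Ω g) with hempty | ⟨⟨x, hx⟩⟩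
  · simp
  have : Nontrivial G := ⟨g, 1, hg⟩
  obtain ⟨N, hN, hNbot, hcomm⟩ := exists_normal_abelian hs
  have : MulAction.IsPretransitive N Ω := isPretransitive_of_normal_ne_bot hNbot
  have hbij := bijective_smul_of_commute hcomm x
  let _ : CommGroup N :=
    { (inferInstance : Group N) with
      mul_comm := fun a b => Subtype.ext (hcomm a a.2 b b.2) }
  let H := MulAction.stabilizer G x
  let _ : DistribMulAction H (Additive N) :=
    { smul := fun h n => Additive.ofMul (MulAut.conjNormal (h : G) n.toMul)
      one_smul := fun n => by
        change Additive.ofMul (MulAut.conjNormal ((1 : H) : G) n.toMul) = n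
        simp
      mul_smul := fun h k n => by
        change Additive.ofMul (MulAut.conjNormal ((h * k : H) : G) n.toMul) =
          Additive.ofMul (MulAut.conjNormal (h : G) (MulAut.conjNormal (k : G) n.toMul))
        simp
      smul_zero := fun h => map_one (MulAut.conjNormal (h : G))
      smul_add := fun h m n => map_mul (MulAut.conjNormal (h : G)) m.toMul n.toMul }
  have smul_def : ∀ (h : H) (n : N),
      h • Additive.ofMul n = Additive.ofMul (MulAut.conjNormal (h : G) n) := fun _ _ => rfl
  have conj_smul : ∀ (h : H) (n : N), MulAut.conjNormal (h : G) n • x = (h : G) • n • x := by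
    intro h n
    change ((MulAut.conjNormal (h : G) n : N) : G) • x = (h : G) • (n : G) • x
    rw [MulAut.conjNormal_apply, mul_smul, mul_smul, inv_smul_eq_iff.2 (h.2 : (h : G) • x = x).symm]
  have fixed_iff : ∀ (h : H) (n : N),
      h • Additive.ofMul n = Additive.ofMul n ↔ (h : G) • n • x = n • x := by
    intro h n
    rw [smul_def, ← conj_smul, Additive.ofMul.apply_eq_iff_eq]
    exact hbij.injective.eq_iff.symm
  have hfaithful : FaithfulSMul H (Additive N) := by
    refine ⟨fun {h k} hhk => Subtype.ext (FaithfulSMul.eq_of_smul_eq_smul fun y : Ω => ?_)⟩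
    obtain ⟨n, rfl⟩ := hbij.surjective y
    change (h : G) • n • x = (k : G) • n • x
    rw [← conj_smul, ← conj_smul]
    exact congrArg (fun m : Additive N => m.toMul • x) (hhk (Additive.ofMul n))
  have hirr : IsIrreducibleAction H (Additive N) := by
    intro W hW
    let M : Subgroup G := (AddSubgroup.toSubgroup' W).map N.subtype
    have mem_M : ∀ n : N, (n : G) ∈ M ↔ Additive.ofMul n ∈ W := by
      intro n
      refine ⟨?_, fun hn => ⟨n, hn, rfl⟩⟩
      rintro ⟨m, hm, hmn⟩
      exact (Subtype.ext hmn : m = n) ▸ hm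
    have hM : M.Normal := by
      refine ⟨?_⟩
      rintro _ ⟨m, hm, rfl⟩ k
      obtain ⟨n, hn⟩ := hbij.surjective (k • x)
      have hnk : (n : G)⁻¹ * k ∈ H := by
        rw [MulAction.mem_stabilizer_iff, mul_smul, inv_smul_eq_iff]
        exact hn.symm
      have h1 := (mem_M _).2 (hW ⟨_, hnk⟩ (Additive.ofMul m) hm)
      have h2 : k * m * k⁻¹ = ((n : G)⁻¹ * k) * m * ((n : G)⁻¹ * k)⁻¹ := by
        have h3 := hcomm n n.2 _ (hN.conj_mem m m.2 k)
        calc k * m * k⁻¹ = (n : G)⁻¹ * (n * (k * m * k⁻¹)) := by group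
          _ = (n : G)⁻¹ * (k * m * k⁻¹ * n) := by rw [h3]
          _ = _ := by group
      change k * m * k⁻¹ ∈ M
      rw [h2]
      exact h1
    by_cases hMbot : M = ⊥
    · left
      refine (AddSubgroup.eq_bot_iff_forall W).2 fun w hw => ?_
      have := (mem_M w.toMul).2 hw
      rw [hMbot, Subgroup.mem_bot] at this
      exact congrArg Additive.ofMul (Subtype.ext this : w.toMul = 1)
    · right
      have : MulAction.IsPretransitive M Ω := isPretransitive_of_normal_ne_bot hMbot
      refine eq_top_iff.2 fun n _ => ?_
      obtain ⟨⟨_, m, hm, rfl⟩, hmn⟩ := MulAction.exists_smul_eq M x (n.toMul • x)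
      have hm' : m = n.toMul := hbij.injective hmn
      subst hm'
      exact hm
  have hgH : (⟨g, hx⟩ : H) ≠ 1 := fun h => hg (congrArg Subtype.val h)
  have hsH : Group.IsSolvable H := inferInstance
  have hcard : Nat.card (Additive N) = Nat.card Ω := Nat.card_congr (Equiv.ofBijective _ hbij)
  refine le_trans (le_of_eq (Nat.card_congr ?_).symm)
    (card_fixed_le_two hsH hirr (hcard ▸ hp) hgH)
  exact Equiv.subtypeEquiv (Additive.toMul.trans (Equiv.ofBijective _ hbij))
    fun n => fixed_iff ⟨g, hx⟩ n.toMul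

end Permutation

end MersenneFixedPoint

/-- If |Ω| = 2^k with 2^k − 1 a (Mersenne) prime, every nonidentity element of a
primitive solvable subgroup of Sym(Ω) has at most 2 fixed points. -/
theorem mersenne_fixed_point_bound {Ω : Type*} [Fintype Ω] [Nonempty Ω]
    (k : ℕ) (G : Subgroup (Equiv.Perm Ω))
    (hcard : Fintype.card Ω = 2 ^ k) (hmersenne : Nat.Prime (2 ^ k - 1))
    (hprim : IsPrimitivePermSubgroup G) (hsolv : IsSolvable G)
    (g : G) (hg : g ≠ 1) :
    Nat.card {x : Ω | (g : Equiv.Perm Ω) x = x} ≤ 2 := by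
  have htrans := hprim.1
  have hnontriv : Nontrivial Ω := by
    rw [← Fintype.one_lt_card_iff_nontrivial, hcard]
    have := hmersenne.two_le
    omega
  have : MulAction.IsPreprimitive G Ω :=
    (MulAction.isCoatom_stabilizer_iff_preprimitive G (Classical.arbitrary Ω)).1 (hprim.2 _)
  exact MersenneFixedPoint.card_fixedBy_le_two hsolv
    (by rwa [Nat.card_eq_fintype_card, hcard]) hg
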